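/- Assume ζ is an initial segment of I, X ∈ Pe(ζ), X' ⊆ X is open in the relative topology of X, and x₀ ∈ X'. Then there exists a set X'' ∈ Pe(ζ) with X'' ⊆ X', X'' clopen in X, and x₀ ∈ X''. -/

import Mathlib

open Set

abbrev Cantor : Type := ℕ → Bool

section
variable {I : Type}

/-- Restriction of a point of `D^η` to `D^ξ` (for `ξ ⊆ η`). -/
def restrictFn {ξ η : Set I} (h : ξ ⊆ η) (x : ↥η → Cantor) : ↥ξ → Cantor :=
  fun j => x ⟨j.1, h j.2⟩

/-- Projection `X↾ξ` of a set `X ⊆ D^η`. -/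
def resSet {ξ η : Set I} (h : ξ ⊆ η) (X : Set (↥η → Cantor)) : Set (↥ξ → Cantor) :=
  restrictFn h '' X

/-- Inverse projection `Y↾⁻¹η` of a set `Y ⊆ D^ξ`. -/
def resPre {ξ η : Set I} (h : ξ ⊆ η) (Y : Set (↥ξ → Cantor)) : Set (↥η → Cantor) :=
  {y | restrictFn h y ∈ Y}

/-- `A` is (relatively) open in `B`. -/
def RelOpen {α : Type*} [TopologicalSpace α] (A B : Set α) : Prop :=
  ∃ U, IsOpen U ∧ A = U ∩ B

/-- `A` is (relatively) closed in `B`. -/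
def RelClosed {α : Type*} [TopologicalSpace α] (A B : Set α) : Prop :=
  ∃ U, IsClosed U ∧ A = U ∩ B

/-- `A` is (relatively) clopen in `B`. -/
def RelClopen {α : Type*} [TopologicalSpace α] (A B : Set α) : Prop :=
  RelOpen A B ∧ RelClosed A B

open Classical in
/-- The union `x ∪ y` of two partial points agreeing on the common domain. -/
noncomputable def glue {ξ η : Set I} (x : ↥ξ → Cantor) (y : ↥η → Cantor) :
    ↥(ξ ∪ η) → Cantor :=
  fun j => if h : j.1 ∈ ξ then x ⟨j.1, h⟩
           else y ⟨j.1, ((Set.mem_union j.1 ξ η).mp j.2).resolve_left h⟩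

variable [PartialOrder I]

/-- `[<i]`. -/
def seg (i : I) : Set I := {j | j < i}

/-- `[≤i]`. -/
def segLe (i : I) : Set I := {j | j ≤ i}

/-- `[≯i]`. -/
def segNG (i : I) : Set I := {j | ¬ i < j}

lemma seg_subset {ζ : Set I} (hζ : IsLowerSet ζ) {i : I} (hi : i ∈ ζ) : seg i ⊆ ζ :=
  fun _ hj => hζ (le_of_lt hj) hi

lemma segLe_subset {ζ : Set I} (hζ : IsLowerSet ζ) {i : I} (hi : i ∈ ζ) : segLe i ⊆ ζ :=
  fun _ hj => hζ hj hi

lemma isLowerSet_segLe (i : I) : IsLowerSet (segLe i) :=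
  fun _ _ hba ha => le_trans hba ha

lemma seg_subset_segLe (i : I) : seg i ⊆ segLe i :=
  fun _ hj => le_of_lt hj

lemma mem_segLe_self (i : I) : i ∈ segLe i := le_refl i

/-- `D_{Xz}(i) = {x(i) : x ∈ X, x↾(<i) = z}`. -/
def Dxz {ζ : Set I} (X : Set (↥ζ → Cantor)) {i : I} (hi : i ∈ ζ) (h : seg i ⊆ ζ)
    (z : ↥(seg i) → Cantor) : Set Cantor :=
  {c | ∃ x ∈ X, restrictFn h x = z ∧ x ⟨i, hi⟩ = c}

/-- Pre-conditions `IPe(ζ)`. -/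
def IPe (ζ : Set I) (hζ : IsLowerSet ζ) (X : Set (↥ζ → Cantor)) : Prop :=
  -- P-1
  (IsClosed X ∧ X.Nonempty) ∧
  -- P-2
  (∀ (i : I) (hi : i ∈ ζ), ∀ z ∈ resSet (seg_subset hζ hi) X,
      Perfect (Dxz X hi (seg_subset hζ hi) z)) ∧
  -- P-3
  (∀ (i : I) (hi : i ∈ ζ), ∀ G : Set Cantor, IsOpen G →
      RelOpen
        ({z | ∃ x ∈ X, x ⟨i, hi⟩ ∈ G ∧ restrictFn (seg_subset hζ hi) x = z} :
          Set (↥(seg i) → Cantor))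
        (resSet (seg_subset hζ hi) X)) ∧
  -- P-4
  (∀ ξ η : Set I, IsLowerSet ξ → IsLowerSet η → ∀ (hξ : ξ ⊆ ζ) (hη : η ⊆ ζ),
      ∀ x ∈ resSet hξ X, ∀ y ∈ resSet hη X,
        restrictFn (Set.inter_subset_left : ξ ∩ η ⊆ ξ) x =
          restrictFn (Set.inter_subset_right : ξ ∩ η ⊆ η) y →
        glue x y ∈ resSet (Set.union_subset hξ hη) X)

/-- `stem(A)`: the length of the longest common initial segment of members of `A`. -/
noncomputable def stem (A : Set Cantor) : ℕ :=
  sInf {n | ∃ a ∈ A, ∃ b ∈ A, a n ≠ b n}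

/-- `Spl(A,e)` for `A ⊆ D`. -/
def SplD (A : Set Cantor) (e : Bool) : Set Cantor :=
  {a ∈ A | a (stem A) = e}

/-- `Spl(X,i,e)` for `X ⊆ D^ζ`. -/
def Spl {ζ : Set I} (hζ : IsLowerSet ζ) (X : Set (↥ζ → Cantor)) {i : I} (hi : i ∈ ζ)
    (e : Bool) : Set (↥ζ → Cantor) :=
  {x ∈ X |
    x ⟨i, hi⟩ ∈
      SplD (Dxz X hi (seg_subset hζ hi) (restrictFn (seg_subset hζ hi) x)) e}

/-- A `ζ`-admissible function: `Φ : ω → ζ` taking each value of `ζ` infinitely often. -/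
def Admissible (ζ : Set I) (Φ : ℕ → I) : Prop :=
  (∀ n, Φ n ∈ ζ) ∧ ∀ i ∈ ζ, ∀ N : ℕ, ∃ n, N ≤ n ∧ Φ n = i

/-- The sets `X_Φ[u]` for finite binary sequences `u`. -/
def XPhi {ζ : Set I} (hζ : IsLowerSet ζ) (Φ : ℕ → I) (hΦ : ∀ n, Φ n ∈ ζ)
    (X : Set (↥ζ → Cantor)) : (m : ℕ) → (Fin m → Bool) → Set (↥ζ → Cantor)
  | 0, _ => X
  | m + 1, u =>
      Spl hζ (XPhi hζ Φ hΦ X m (fun k => u k.castSucc)) (hΦ m) (u (Fin.last m))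

/-- `X` is shrinkable: each `X_Φ[a]` is a singleton. -/
def Shrinkable {ζ : Set I} (hζ : IsLowerSet ζ) (X : Set (↥ζ → Cantor)) : Prop :=
  ∀ (Φ : ℕ → I) (hΦ : Admissible ζ Φ) (a : ℕ → Bool),
    ∃ x, (⋂ m : ℕ, XPhi hζ Φ hΦ.1 X m (fun k => a k.1)) = {x}

/-- Conditions `Pe(ζ)`: shrinkable pre-conditions. -/
def Pe (ζ : Set I) (hζ : IsLowerSet ζ) (X : Set (↥ζ → Cantor)) : Prop :=
  IPe ζ hζ X ∧ Shrinkable hζ X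

/-- `Perf = Pe(I)`. -/
def Perf (X : Set (↥(Set.univ : Set I) → Cantor)) : Prop :=
  Pe Set.univ isLowerSet_univ X

/-- The initial segments `ξ[u,v]`. -/
def xiUV (Φ : ℕ → I) : (m : ℕ) → (Fin m → Bool) → (Fin m → Bool) → Set I
  | 0, _, _ => Set.univ
  | m + 1, u, v =>
      if u (Fin.last m) = v (Fin.last m) then
        xiUV Φ m (fun k => u k.castSucc) (fun k => v k.castSucc)
      else
        xiUV Φ m (fun k => u k.castSucc) (fun k => v k.castSucc) ∩ segNG (Φ m)

/-- A `Φ`-splitting system of order `m`. -/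
def SplittingSystem (Φ : ℕ → I) (m : ℕ)
    (X : (n : ℕ) → (Fin n → Bool) → Set (↥(Set.univ : Set I) → Cantor)) : Prop :=
  (∀ n, n ≤ m → ∀ u : Fin n → Bool, Perf (X n u)) ∧
  -- S-1
  (∀ n, n < m → ∀ (u : Fin n → Bool) (e : Bool),
      X (n + 1) (Fin.snoc u e) ⊆
        Spl isLowerSet_univ (X n u) (Set.mem_univ (Φ n)) e) ∧
  -- S-2
  (∀ n, n ≤ m → ∀ u v : Fin n → Bool,
      resSet (Set.subset_univ (xiUV Φ n u v)) (X n u) =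
        resSet (Set.subset_univ (xiUV Φ n u v)) (X n v)) ∧
  -- S-3
  (∀ n, n ≤ m → ∀ u v : Fin n → Bool, ∀ i : I, i ∉ xiUV Φ n u v →
      resSet (Set.subset_univ (segLe i)) (X n u) ∩
        resSet (Set.subset_univ (segLe i)) (X n v) = ∅)

/-- `F` is reducible to `ξ` on `X`. -/
def Reducible {β : Type*} (F : (↥(Set.univ : Set I) → Cantor) → β) (ξ : Set I)
    (X : Set (↥(Set.univ : Set I) → Cantor)) : Prop :=
  ∀ x ∈ X, ∀ y ∈ X,
    restrictFn (Set.subset_univ ξ) x = restrictFn (Set.subset_univ ξ) y → F x = F y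

/-- `F` captures `i` on `X`. -/
def Captures {β : Type*} (F : (↥(Set.univ : Set I) → Cantor) → β) (i : I)
    (X : Set (↥(Set.univ : Set I) → Cantor)) : Prop :=
  ∀ x ∈ X, ∀ y ∈ X, F x = F y → x ⟨i, Set.mem_univ i⟩ = y ⟨i, Set.mem_univ i⟩

/-- Borel sets of finite level: level `0` = closed sets, level `n+1` = countable
unions or countable intersections of sets of level `n`. -/
def BorelLevel {α : Type*} [TopologicalSpace α] : ℕ → Set (Set α)
  | 0 => {C | IsClosed C}
  | n + 1 =>
      {S | (∃ f : ℕ → Set α, (∀ k, f k ∈ BorelLevel n) ∧ S = ⋃ k, f k) ∨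
           (∃ f : ℕ → Set α, (∀ k, f k ∈ BorelLevel n) ∧ S = ⋂ k, f k)}

end

open Filter Topology

section
variable {I : Type}

lemma restrictFn_eq_iff {ξ ζ : Set I} (h : ξ ⊆ ζ) (x y : ↥ζ → Cantor) :
    restrictFn h x = restrictFn h y ↔ ∀ k : ζ, k.1 ∈ ξ → x k = y k := by
  constructor
  · intro H k hk
    exact congrFun H ⟨k.1, hk⟩
  · intro H
    funext j
    exact H ⟨j.1, h j.2⟩ j.2

lemma continuous_restrictFn {ξ ζ : Set I} (h : ξ ⊆ ζ) :
    Continuous (restrictFn h : (↥ζ → Cantor) → _) :=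
  continuous_pi fun _ => continuous_apply _

lemma relOpen_of_forall_nhdsWithin {α : Type*} [TopologicalSpace α] {A B : Set α}
    (hAB : A ⊆ B) (h : ∀ z ∈ A, ∀ᶠ w in 𝓝[B] z, w ∈ A) : RelOpen A B := by
  choose! U hU using fun z hz => mem_nhdsWithin.mp (h z hz)
  refine ⟨⋃ z ∈ A, U z, isOpen_biUnion fun z hz => (hU z hz).1, ?_⟩
  ext w
  simp only [mem_inter_iff, mem_iUnion, exists_prop]
  constructor
  · intro hw
    exact ⟨⟨w, hw, (hU w hw).2.1⟩, hAB hw⟩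
  · rintro ⟨⟨z, hz, hwz⟩, hwB⟩
    exact (hU z hz).2.2 ⟨hwz, hwB⟩

lemma RelOpen.eventually {α : Type*} [TopologicalSpace α] {A B : Set α}
    (h : RelOpen A B) {z : α} (hz : z ∈ A) : ∀ᶠ w in 𝓝[B] z, w ∈ A := by
  obtain ⟨U, hU, rfl⟩ := h
  exact mem_nhdsWithin.mpr ⟨U, hU, hz.1, subset_rfl⟩

lemma RelClopen.trans {α : Type*} [TopologicalSpace α] {A B C : Set α}
    (hAB : RelClopen A B) (hBC : RelClopen B C) : RelClopen A C := by
  obtain ⟨⟨U, hU, hAU⟩, F, hF, hAF⟩ := hAB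
  obtain ⟨⟨V, hV, hBV⟩, E, hE, hBE⟩ := hBC
  refine ⟨⟨U ∩ V, hU.inter hV, ?_⟩, F ∩ E, hF.inter hE, ?_⟩
  · rw [hAU, hBV, inter_assoc]
  · rw [hAF, hBE, inter_assoc]

lemma RelClopen.refl {α : Type*} [TopologicalSpace α] (A : Set α) : RelClopen A A :=
  ⟨⟨univ, isOpen_univ, (univ_inter A).symm⟩, ⟨univ, isClosed_univ, (univ_inter A).symm⟩⟩

lemma isOpen_coord (n : ℕ) (b : Bool) : IsOpen {c : Cantor | c n = b} :=
  (isOpen_discrete ({b} : Set Bool)).preimage (continuous_apply (A := fun _ : ℕ => Bool) n)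

lemma isClosed_coord (n : ℕ) (b : Bool) : IsClosed {c : Cantor | c n = b} :=
  (isClosed_discrete ({b} : Set Bool)).preimage (continuous_apply (A := fun _ : ℕ => Bool) n)

lemma Perfect.exists_ne_at_stem {A : Set Cantor} (hA : Perfect A) (hne : A.Nonempty) :
    ∃ a ∈ A, ∃ b ∈ A, a (stem A) ≠ b (stem A) := by
  obtain ⟨a, ha⟩ := hne
  obtain ⟨b, hb, hab⟩ := accPt_iff_nhds.mp (hA.acc a ha) univ univ_mem
  obtain ⟨n, hn⟩ := Function.ne_iff.mp hab
  exact Nat.sInf_mem (s := {n | ∃ a ∈ A, ∃ b ∈ A, a n ≠ b n}) ⟨n, b, hb.2, a, ha, hn⟩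

lemma Perfect.exists_eq_at_stem {A : Set Cantor} (hA : Perfect A) (hne : A.Nonempty)
    (e : Bool) : ∃ a ∈ A, a (stem A) = e := by
  obtain ⟨a, ha, b, hb, hab⟩ := hA.exists_ne_at_stem hne
  by_cases h : a (stem A) = e
  · exact ⟨a, ha, h⟩
  · exact ⟨b, hb, (Bool.eq_not_of_ne hab.symm).trans (by rw [Bool.eq_not_of_ne h, Bool.not_not])⟩

lemma Perfect.stem_eq {A A' : Set Cantor} (hA : Perfect A) (hne : A.Nonempty)
    (h : ∀ k ≤ stem A, ∀ b : Bool, (∃ a ∈ A', a k = b) ↔ ∃ a ∈ A, a k = b) :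
    stem A' = stem A := by
  have key : ∀ k ≤ stem A,
      ((∃ a ∈ A', ∃ b ∈ A', a k ≠ b k) ↔ ∃ a ∈ A, ∃ b ∈ A, a k ≠ b k) := by
    intro k hk
    constructor
    · rintro ⟨a, ha, b, hb, hab⟩
      obtain ⟨a', ha', e⟩ := (h k hk _).mp ⟨a, ha, rfl⟩
      obtain ⟨b', hb', e'⟩ := (h k hk _).mp ⟨b, hb, rfl⟩
      exact ⟨a', ha', b', hb', by rwa [e, e']⟩
    · rintro ⟨a, ha, b, hb, hab⟩
      obtain ⟨a', ha', e⟩ := (h k hk _).mpr ⟨a, ha, rfl⟩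
      obtain ⟨b', hb', e'⟩ := (h k hk _).mpr ⟨b, hb, rfl⟩
      exact ⟨a', ha', b', hb', by rwa [e, e']⟩
  have hmem := (key _ le_rfl).mpr (hA.exists_ne_at_stem hne)
  have hle : stem A' ≤ stem A := Nat.sInf_le hmem
  refine le_antisymm hle (Nat.sInf_le ((key _ hle).mp ?_))
  exact Nat.sInf_mem (s := {n | ∃ a ∈ A', ∃ b ∈ A', a n ≠ b n}) ⟨_, hmem⟩

lemma exists_admissible [Countable I] {ζ : Set I} (hne : ζ.Nonempty) : ∃ Φ, Admissible ζ Φ := by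
  have := hne.to_subtype
  obtain ⟨f, hf⟩ := exists_surjective_nat ζ
  refine ⟨fun n => f n.unpair.1, fun n => (f _).2, fun i hi N => ?_⟩
  obtain ⟨k, hk⟩ := hf ⟨i, hi⟩
  exact ⟨Nat.pair k N, Nat.right_le_pair k N, by simp [hk]⟩

variable [PartialOrder I]

lemma mem_Dxz_self {ζ : Set I} {X : Set (↥ζ → Cantor)} {i : I} (hi : i ∈ ζ)
    (h : seg i ⊆ ζ) {x : ↥ζ → Cantor} (hx : x ∈ X) :
    x ⟨i, hi⟩ ∈ Dxz X hi h (restrictFn h x) := ⟨x, hx, rfl, rfl⟩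

lemma mem_Spl_iff {ζ : Set I} {hζ : IsLowerSet ζ} {X : Set (↥ζ → Cantor)} {i : I}
    {hi : i ∈ ζ} {e : Bool} {x : ↥ζ → Cantor} :
    x ∈ Spl hζ X hi e ↔ x ∈ X ∧ x ⟨i, hi⟩ (stem (Dxz X hi (seg_subset hζ hi)
      (restrictFn (seg_subset hζ hi) x))) = e :=
  ⟨fun h => ⟨h.1, h.2.2⟩, fun h => ⟨h.1, mem_Dxz_self hi _ h.1, h.2⟩⟩

lemma mem_Spl_of_agree {ζ : Set I} {hζ : IsLowerSet ζ} {X : Set (↥ζ → Cantor)} {i : I}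
    {hi : i ∈ ζ} {e : Bool} {x y : ↥ζ → Cantor} (hx : x ∈ X) (hy : y ∈ Spl hζ X hi e)
    (hxy : ∀ k : ζ, k.1 ≤ i → x k = y k) : x ∈ Spl hζ X hi e := by
  rw [mem_Spl_iff] at hy ⊢
  refine ⟨hx, ?_⟩
  rw [(restrictFn_eq_iff (seg_subset hζ hi) x y).mpr fun k hk => hxy k (le_of_lt hk),
    hxy ⟨i, hi⟩ le_rfl]
  exact hy.2

namespace IPe

variable {ζ : Set I} {hζ : IsLowerSet ζ} {X : Set (↥ζ → Cantor)}

lemma exists_amalgam (hX : IPe ζ hζ X) {ξ η : Set I} (hξ : IsLowerSet ξ) (hη : IsLowerSet η)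
    (hξζ : ξ ⊆ ζ) (hηζ : η ⊆ ζ) {x y : ↥ζ → Cantor} (hx : x ∈ X) (hy : y ∈ X)
    (hxy : ∀ k : ζ, k.1 ∈ ξ → k.1 ∈ η → x k = y k) :
    ∃ w ∈ X, (∀ k : ζ, k.1 ∈ ξ → w k = x k) ∧ (∀ k : ζ, k.1 ∈ η → w k = y k) ∧
      restrictFn (union_subset hξζ hηζ) w = glue (restrictFn hξζ x) (restrictFn hηζ y) := by
  obtain ⟨w, hw, hwg⟩ := hX.2.2.2 ξ η hξ hη hξζ hηζ _ ⟨x, hx, rfl⟩ _ ⟨y, hy, rfl⟩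
    (funext fun j => hxy ⟨j.1, hξζ j.2.1⟩ j.2.1 j.2.2)
  have hwξ : ∀ k : ζ, k.1 ∈ ξ → w k = x k := by
    intro k hk
    have := congrFun hwg ⟨k.1, Or.inl hk⟩
    simpa [glue, restrictFn, hk] using this
  refine ⟨w, hw, hwξ, ?_, hwg⟩
  intro k hk
  by_cases hkξ : k.1 ∈ ξ
  · rw [hwξ k hkξ, hxy k hkξ hk]
  · have := congrFun hwg ⟨k.1, Or.inr hk⟩
    simpa [glue, restrictFn, hkξ] using this

variable {i : I} {hi : i ∈ ζ}

lemma perfect_Dxz (hX : IPe ζ hζ X) (hi : i ∈ ζ) {x : ↥ζ → Cantor} (hx : x ∈ X) :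
    Perfect (Dxz X hi (seg_subset hζ hi) (restrictFn (seg_subset hζ hi) x)) :=
  hX.2.1 i hi _ ⟨x, hx, rfl⟩

/-- On the projection `X↾[<i]`, whether `D_{Xz}(i)` meets a given clopen set is locally
constant in `z`. -/
lemma eventually_meets_iff (hX : IPe ζ hζ X) (hi : i ∈ ζ) {G : Set Cantor} (hG : IsClopen G)
    (z : ↥(seg i) → Cantor) :
    ∀ᶠ w in 𝓝[resSet (seg_subset hζ hi) X] z,
      (∃ a ∈ Dxz X hi (seg_subset hζ hi) w, a ∈ G) ↔
        ∃ a ∈ Dxz X hi (seg_subset hζ hi) z, a ∈ G := by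
  by_cases h : ∃ a ∈ Dxz X hi (seg_subset hζ hi) z, a ∈ G
  · have hmem : z ∈ {z | ∃ x ∈ X, x ⟨i, hi⟩ ∈ G ∧ restrictFn (seg_subset hζ hi) x = z} := by
      obtain ⟨_, ⟨x, hx, hxz, rfl⟩, ha⟩ := h
      exact ⟨x, hx, ha, hxz⟩
    filter_upwards [(hX.2.2.1 i hi G hG.isOpen).eventually hmem] with w hw
    obtain ⟨x, hx, ha, hxw⟩ := hw
    exact iff_of_true ⟨_, ⟨x, hx, hxw, rfl⟩, ha⟩ h
  · have hcl : IsClosed (restrictFn (seg_subset hζ hi) '' (X ∩ {x | x ⟨i, hi⟩ ∈ G})) :=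
      ((hX.1.1.inter (hG.isClosed.preimage (continuous_apply _))).isCompact.image
        (continuous_restrictFn _)).isClosed
    have hmem : z ∈ (restrictFn (seg_subset hζ hi) '' (X ∩ {x | x ⟨i, hi⟩ ∈ G}))ᶜ := by
      rintro ⟨x, ⟨hx, ha⟩, hxz⟩
      exact h ⟨_, ⟨x, hx, hxz, rfl⟩, ha⟩
    filter_upwards [mem_nhdsWithin_of_mem_nhds (hcl.isOpen_compl.mem_nhds hmem)] with w hw
    refine iff_of_false ?_ h
    rintro ⟨_, ⟨x, hx, hxw, rfl⟩, ha⟩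
    exact hw ⟨x, ⟨hx, ha⟩, hxw⟩

lemma eventually_stem_eq (hX : IPe ζ hζ X) (hi : i ∈ ζ) (z : ↥(seg i) → Cantor)
    (hz : z ∈ resSet (seg_subset hζ hi) X) :
    ∀ᶠ w in 𝓝[resSet (seg_subset hζ hi) X] z,
      stem (Dxz X hi (seg_subset hζ hi) w) = stem (Dxz X hi (seg_subset hζ hi) z) := by
  have hne : (Dxz X hi (seg_subset hζ hi) z).Nonempty := by
    obtain ⟨x, hx, rfl⟩ := hz
    exact ⟨_, mem_Dxz_self hi _ hx⟩
  have key : ∀ᶠ w in 𝓝[resSet (seg_subset hζ hi) X] z,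
      ∀ k ∈ Iic (stem (Dxz X hi (seg_subset hζ hi) z)), ∀ b : Bool,
        (∃ a ∈ Dxz X hi (seg_subset hζ hi) w, a k = b) ↔
          ∃ a ∈ Dxz X hi (seg_subset hζ hi) z, a k = b := by
    rw [eventually_all_finite (finite_Iic _)]
    intro k _
    rw [eventually_all]
    intro b
    exact hX.eventually_meets_iff hi ⟨isClosed_coord k b, isOpen_coord k b⟩ z
  filter_upwards [key] with w hw
  exact (hX.2.1 i hi z hz).stem_eq hne hw

lemma relClopen_Spl (hX : IPe ζ hζ X) (hi : i ∈ ζ) (e : Bool) :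
    RelClopen (Spl hζ X hi e) X := by
  have hcont : ContinuousOn (fun x : ↥ζ → Cantor => x ⟨i, hi⟩ (stem (Dxz X hi
      (seg_subset hζ hi) (restrictFn (seg_subset hζ hi) x)))) X := by
    intro x hx
    have htend : Tendsto (restrictFn (seg_subset hζ hi)) (𝓝[X] x)
        (𝓝[resSet (seg_subset hζ hi) X] (restrictFn (seg_subset hζ hi) x)) :=
      (continuous_restrictFn _).continuousWithinAt.tendsto_nhdsWithin
        fun y hy => ⟨y, hy, rfl⟩
    have hstem := htend.eventually (hX.eventually_stem_eq hi _ ⟨x, hx, rfl⟩)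
    set n := stem (Dxz X hi (seg_subset hζ hi) (restrictFn (seg_subset hζ hi) x)) with hn
    have hc : ContinuousWithinAt (fun y : ↥ζ → Cantor => y ⟨i, hi⟩ n) X x :=
      Continuous.continuousWithinAt (by fun_prop)
    refine hc.congr_of_eventuallyEq ?_ rfl
    filter_upwards [hstem] with y hy
    rw [hy]
  have heq : Spl hζ X hi e = (fun x : ↥ζ → Cantor => x ⟨i, hi⟩ (stem (Dxz X hi
      (seg_subset hζ hi) (restrictFn (seg_subset hζ hi) x)))) ⁻¹' {e} ∩ X := by
    ext x
    rw [mem_Spl_iff, and_comm]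
    rfl
  rw [heq]
  exact ⟨continuousOn_iff'.mp hcont _ (isOpen_discrete _),
    continuousOn_iff_isClosed.mp hcont _ (isClosed_discrete _)⟩

/-- `Spl(X,i,e)` and `X` have the same projection to an initial segment avoiding `i`. -/
lemma exists_mem_Spl_agree (hX : IPe ζ hζ X) (hi : i ∈ ζ) (e : Bool) {ξ : Set I}
    (hξ : IsLowerSet ξ) (hξζ : ξ ⊆ ζ) (hiξ : i ∉ ξ) {x : ↥ζ → Cantor} (hx : x ∈ X) :
    ∃ w ∈ Spl hζ X hi e, ∀ k : ζ, k.1 ∈ ξ → w k = x k := by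
  obtain ⟨_, ⟨y, hy, hyx, rfl⟩, hye⟩ :=
    (hX.perfect_Dxz hi hx).exists_eq_at_stem ⟨_, mem_Dxz_self hi _ hx⟩ e
  have hyS : y ∈ Spl hζ X hi e := mem_Spl_iff.mpr ⟨hy, by rw [hyx]; exact hye⟩
  rw [restrictFn_eq_iff] at hyx
  obtain ⟨w, hw, hwx, hwy, -⟩ := hX.exists_amalgam hξ (isLowerSet_segLe i) hξζ
    (segLe_subset hζ hi) hx hy fun k hk hki =>
      (hyx k (lt_of_le_of_ne hki fun h => hiξ (h ▸ hk))).symm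
  exact ⟨w, mem_Spl_of_agree hw hyS hwy, hwx⟩

lemma exists_mem_Spl_agree_segLe (hX : IPe ζ hζ X) {e : Bool} {j : I}
    (hj : j ∈ ζ) (hji : j ≠ i) {x y : ↥ζ → Cantor} (hx : x ∈ X) (hy : y ∈ Spl hζ X hi e)
    (hxy : restrictFn (seg_subset hζ hj) x = restrictFn (seg_subset hζ hj) y) :
    ∃ w ∈ Spl hζ X hi e, restrictFn (seg_subset hζ hj) w = restrictFn (seg_subset hζ hj) x ∧
      w ⟨j, hj⟩ = x ⟨j, hj⟩ := by
  by_cases hij : i ≤ j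
  · refine ⟨x, mem_Spl_of_agree hx hy fun k hk => ?_, rfl, rfl⟩
    exact (restrictFn_eq_iff _ x y).mp hxy k (lt_of_le_of_lt hk (lt_of_le_of_ne hij hji.symm))
  · obtain ⟨w, hw, hwx⟩ := hX.exists_mem_Spl_agree hi e (isLowerSet_segLe j)
      (segLe_subset hζ hj) hij hx
    exact ⟨w, hw, (restrictFn_eq_iff _ _ _).mpr fun k hk => hwx k (le_of_lt hk),
      hwx _ le_rfl⟩

lemma isClosed_Spl (hX : IPe ζ hζ X) (hi : i ∈ ζ) (e : Bool) : IsClosed (Spl hζ X hi e) := by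
  obtain ⟨F, hF, h⟩ := (hX.relClopen_Spl hi e).2
  rw [h]
  exact hF.inter hX.1.1

lemma Dxz_Spl_self {e : Bool} (z : ↥(seg i) → Cantor) :
    Dxz (Spl hζ X hi e) hi (seg_subset hζ hi) z =
      {c | c (stem (Dxz X hi (seg_subset hζ hi) z)) = e} ∩
        Dxz X hi (seg_subset hζ hi) z := by
  ext c
  constructor
  · rintro ⟨x, hx, rfl, rfl⟩
    rw [mem_Spl_iff] at hx
    exact ⟨hx.2, mem_Dxz_self hi _ hx.1⟩
  · rintro ⟨hc, x, hx, rfl, rfl⟩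
    exact ⟨x, mem_Spl_iff.mpr ⟨hx, hc⟩, rfl, rfl⟩

lemma perfect_Dxz_Spl (hX : IPe ζ hζ X) {e : Bool} {j : I} (hj : j ∈ ζ)
    (z : ↥(seg j) → Cantor) (hz : z ∈ resSet (seg_subset hζ hj) (Spl hζ X hi e)) :
    Perfect (Dxz (Spl hζ X hi e) hj (seg_subset hζ hj) z) := by
  obtain ⟨y, hy, rfl⟩ := hz
  have hperf := hX.perfect_Dxz hj hy.1
  by_cases hji : j = i
  · subst hji
    rw [Dxz_Spl_self]
    exact ⟨(isClosed_coord _ _).inter hperf.closed, hperf.acc.open_inter (isOpen_coord _ _)⟩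
  · convert hperf using 1
    ext c
    constructor
    · rintro ⟨x, hx, hxy, rfl⟩
      exact ⟨x, hx.1, hxy, rfl⟩
    · rintro ⟨x, hx, hxy, rfl⟩
      obtain ⟨w, hw, hwx, hwj⟩ := hX.exists_mem_Spl_agree_segLe hj hji hx hy hxy
      exact ⟨w, hw, hwx.trans hxy, hwj⟩

lemma relOpen_Spl (hX : IPe ζ hζ X) {e : Bool} {j : I} (hj : j ∈ ζ)
    {G : Set Cantor} (hG : IsOpen G) :
    RelOpen {z | ∃ x ∈ Spl hζ X hi e, x ⟨j, hj⟩ ∈ G ∧ restrictFn (seg_subset hζ hj) x = z}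
      (resSet (seg_subset hζ hj) (Spl hζ X hi e)) := by
  by_cases hji : j = i
  · subst hji
    refine relOpen_of_forall_nhdsWithin ?_ ?_
    · rintro _ ⟨x, hx, -, rfl⟩
      exact ⟨x, hx, rfl⟩
    · rintro _ ⟨x, hx, hxG, rfl⟩
      have hxS := mem_Spl_iff.mp hx
      set n := stem (Dxz X hi (seg_subset hζ hi) (restrictFn (seg_subset hζ hi) x)) with hn
      have hopen := (hX.2.2.1 _ hi _ (hG.inter (isOpen_coord n e))).eventually
        ⟨x, hxS.1, ⟨hxG, hxS.2⟩, rfl⟩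
      have hstem := hX.eventually_stem_eq hi _ ⟨x, hxS.1, rfl⟩
      have hle : 𝓝[resSet (seg_subset hζ hi) (Spl hζ X hi e)]
          (restrictFn (seg_subset hζ hi) x) ≤
          𝓝[resSet (seg_subset hζ hi) X] (restrictFn (seg_subset hζ hi) x) :=
        nhdsWithin_mono _ (image_mono fun _ h => h.1)
      filter_upwards [hopen.filter_mono hle, hstem.filter_mono hle] with w hw hwn
      obtain ⟨y, hy, ⟨hyG, hyn⟩, rfl⟩ := hw
      exact ⟨y, mem_Spl_iff.mpr ⟨hy, by rw [hwn]; exact hyn⟩, hyG, rfl⟩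
  · obtain ⟨U, hU, hUeq⟩ := hX.2.2.1 j hj G hG
    refine ⟨U, hU, ?_⟩
    ext z
    constructor
    · rintro ⟨x, hx, hxG, rfl⟩
      exact ⟨(hUeq.subset ⟨x, hx.1, hxG, rfl⟩).1, x, hx, rfl⟩
    · rintro ⟨hzU, y, hy, rfl⟩
      obtain ⟨x, hx, hxG, hxy⟩ := hUeq.superset ⟨hzU, y, hy.1, rfl⟩
      obtain ⟨w, hw, hwx, hwj⟩ := hX.exists_mem_Spl_agree_segLe hj hji hx hy hxy
      exact ⟨w, hw, by rwa [hwj], hwx.trans hxy⟩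

lemma glue_mem_Spl (hX : IPe ζ hζ X) {e : Bool} {ξ η : Set I} (hξ : IsLowerSet ξ)
    (hη : IsLowerSet η) (hξζ : ξ ⊆ ζ) (hηζ : η ⊆ ζ) {x y : ↥ζ → Cantor}
    (hx : x ∈ Spl hζ X hi e) (hy : y ∈ Spl hζ X hi e)
    (hxy : ∀ k : ζ, k.1 ∈ ξ → k.1 ∈ η → x k = y k) :
    glue (restrictFn hξζ x) (restrictFn hηζ y) ∈
      resSet (union_subset hξζ hηζ) (Spl hζ X hi e) := by
  obtain ⟨w, hw, hwx, hwy, hwg⟩ := hX.exists_amalgam hξ hη hξζ hηζ hx.1 hy.1 hxy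
  by_cases hiξ : i ∈ ξ
  · exact ⟨w, mem_Spl_of_agree hw hx fun k hk => hwx k (hξ hk hiξ), hwg⟩
  by_cases hiη : i ∈ η
  · exact ⟨w, mem_Spl_of_agree hw hy fun k hk => hwy k (hη hk hiη), hwg⟩
  obtain ⟨v, hv, hvw⟩ := hX.exists_mem_Spl_agree hi e (hξ.union hη)
    (union_subset hξζ hηζ) (fun h => h.elim hiξ hiη) hw
  exact ⟨v, hv, ((restrictFn_eq_iff _ v w).mpr hvw).trans hwg⟩

lemma spl (hX : IPe ζ hζ X) (hi : i ∈ ζ) (e : Bool) : IPe ζ hζ (Spl hζ X hi e) := by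
  refine ⟨⟨hX.isClosed_Spl hi e, ?_⟩, fun j hj => hX.perfect_Dxz_Spl hj,
    fun j hj G hG => hX.relOpen_Spl hj hG, ?_⟩
  · obtain ⟨x, hx⟩ := hX.1.2
    obtain ⟨w, hw, -⟩ := hX.exists_mem_Spl_agree hi e isLowerSet_empty (empty_subset _)
      (notMem_empty _) hx
    exact ⟨w, hw⟩
  · rintro ξ η hξ hη hξζ hηζ _ ⟨x, hx, rfl⟩ _ ⟨y, hy, rfl⟩ hxy
    exact hX.glue_mem_Spl hξ hη hξζ hηζ hx hy fun k hkξ hkη => congrFun hxy ⟨k.1, hkξ, hkη⟩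

end IPe

variable {ζ : Set I} {hζ : IsLowerSet ζ} {X : Set (↥ζ → Cantor)}

lemma XPhi_succ_cons {i : I} (hi : i ∈ ζ) (e : Bool) {Φ : ℕ → I} (hΦ : ∀ n, Φ n ∈ ζ)
    (hΦ' : ∀ n, (fun n => Nat.casesOn n i Φ : ℕ → I) n ∈ ζ) (a : ℕ → Bool) (m : ℕ) :
    XPhi hζ (fun n => Nat.casesOn n i Φ) hΦ' X (m + 1)
        (fun k => (fun n => Nat.casesOn n e a : ℕ → Bool) k.1) =
      XPhi hζ Φ hΦ (Spl hζ X hi e) m (fun k => a k.1) := by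
  induction m with
  | zero => rfl
  | succ m ih => exact congrArg (fun Y => Spl hζ Y (hΦ m) (a m)) ih

lemma Shrinkable.spl (hX : Shrinkable hζ X) {i : I} (hi : i ∈ ζ) (e : Bool) :
    Shrinkable hζ (Spl hζ X hi e) := by
  intro Φ hΦ a
  have hΦ' : Admissible ζ (fun n => Nat.casesOn n i Φ) := by
    refine ⟨fun n => ?_, fun j hj N => ?_⟩
    · cases n with
      | zero => exact hi
      | succ n => exact hΦ.1 n
    · obtain ⟨n, hn, rfl⟩ := hΦ.2 j hj N
      exact ⟨n + 1, by omega, rfl⟩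
  obtain ⟨x, hx⟩ := hX _ hΦ' (fun n => Nat.casesOn n e a)
  refine ⟨x, ?_⟩
  rw [← hx]
  ext y
  simp only [mem_iInter]
  constructor
  · intro h m
    cases m with
    | zero => exact (h 0).1
    | succ m =>
      rw [XPhi_succ_cons hi e hΦ.1]
      exact h m
  · intro h m
    rw [← XPhi_succ_cons hi e hΦ.1 hΦ'.1]
    exact h (m + 1)

lemma Pe.spl (hX : Pe ζ hζ X) {i : I} (hi : i ∈ ζ) (e : Bool) :
    Pe ζ hζ (Spl hζ X hi e) :=
  ⟨hX.1.spl hi e, hX.2.spl hi e⟩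

/-- The sets `X_Φ[a↾m]` along the branch `a` determined by the requirement that they all
contain a given point `x`. -/
noncomputable def splitThrough (hζ : IsLowerSet ζ) (Φ : ℕ → I) (hΦ : ∀ n, Φ n ∈ ζ)
    (X : Set (↥ζ → Cantor)) (x : ↥ζ → Cantor) : ℕ → Set (↥ζ → Cantor)
  | 0 => X
  | m + 1 => Spl hζ (splitThrough hζ Φ hΦ X x m) (hΦ m)
      (x ⟨Φ m, hΦ m⟩ (stem (Dxz (splitThrough hζ Φ hΦ X x m) (hΦ m) (seg_subset hζ (hΦ m))
        (restrictFn (seg_subset hζ (hΦ m)) x))))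

lemma exists_XPhi_eq_splitThrough (Φ : ℕ → I) (hΦ : ∀ n, Φ n ∈ ζ) (x : ↥ζ → Cantor) :
    ∃ a : ℕ → Bool, ∀ m,
      XPhi hζ Φ hΦ X m (fun k => a k.1) = splitThrough hζ Φ hΦ X x m := by
  refine ⟨fun m => x ⟨Φ m, hΦ m⟩ (stem (Dxz (splitThrough hζ Φ hΦ X x m) (hΦ m)
    (seg_subset hζ (hΦ m)) (restrictFn (seg_subset hζ (hΦ m)) x))), fun m => ?_⟩
  induction m with
  | zero => rfl
  | succ m ih => exact congrArg (fun Y => Spl hζ Y (hΦ m) _) ih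

lemma splitThrough_antitone (Φ : ℕ → I) (hΦ : ∀ n, Φ n ∈ ζ) (x : ↥ζ → Cantor) :
    Antitone (splitThrough hζ Φ hΦ X x) :=
  antitone_nat_of_succ_le fun _ _ h => h.1

lemma splitThrough_spec (hX : Pe ζ hζ X) {Φ : ℕ → I} (hΦ : ∀ n, Φ n ∈ ζ) {x : ↥ζ → Cantor}
    (hx : x ∈ X) (m : ℕ) :
    Pe ζ hζ (splitThrough hζ Φ hΦ X x m) ∧ RelClopen (splitThrough hζ Φ hΦ X x m) X ∧
      x ∈ splitThrough hζ Φ hΦ X x m := by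
  induction m with
  | zero => exact ⟨hX, .refl X, hx⟩
  | succ m ih =>
    exact ⟨ih.1.spl _ _, (ih.1.1.relClopen_Spl _ _).trans ih.2.1, mem_Spl_iff.mpr ⟨ih.2.2, rfl⟩⟩

lemma iInter_splitThrough (hX : Pe ζ hζ X) {Φ : ℕ → I} (hΦ : Admissible ζ Φ)
    {x : ↥ζ → Cantor} (hx : x ∈ X) : ⋂ m, splitThrough hζ Φ hΦ.1 X x m = {x} := by
  obtain ⟨a, ha⟩ := exists_XPhi_eq_splitThrough (hζ := hζ) (X := X) Φ hΦ.1 x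
  obtain ⟨y, hy⟩ := hX.2 Φ hΦ a
  simp only [ha] at hy
  have hxy : x ∈ ({y} : Set (↥ζ → Cantor)) :=
    hy ▸ mem_iInter.mpr fun m => (splitThrough_spec hX hΦ.1 hx m).2.2
  rw [hy, mem_singleton_iff.mp hxy]

end

theorem stmt9 (I : Type) [PartialOrder I] [Countable I]
    (ζ : Set I) (hζ : IsLowerSet ζ)
    (X : Set (↥ζ → Cantor)) (hX : Pe ζ hζ X)
    (X' : Set (↥ζ → Cantor)) (hX'sub : X' ⊆ X) (hX'open : RelOpen X' X)
    (x₀ : ↥ζ → Cantor) (hx₀ : x₀ ∈ X') :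
    ∃ X'' : Set (↥ζ → Cantor),
      Pe ζ hζ X'' ∧ X'' ⊆ X' ∧ RelClopen X'' X ∧ x₀ ∈ X'' := by
  obtain ⟨U, hU, rfl⟩ := hX'open
  rcases ζ.eq_empty_or_nonempty with rfl | hne
  · refine ⟨X, hX, fun x hx => ⟨?_, hx⟩, .refl X, hx₀.2⟩
    rw [Subsingleton.elim x x₀]
    exact hx₀.1
  obtain ⟨Φ, hΦ⟩ := exists_admissible hne
  have hspec := splitThrough_spec hX hΦ.1 hx₀.2
  obtain ⟨m, hm⟩ := exists_subset_nhds_of_isCompact'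
    (splitThrough_antitone (hζ := hζ) (X := X) Φ hΦ.1 x₀).directed_ge
    (fun m => (hspec m).1.1.1.1.isCompact) (fun m => (hspec m).1.1.1.1)
    (U := U) fun y hy => by
      rw [iInter_splitThrough hX hΦ hx₀.2, mem_singleton_iff] at hy
      exact hy ▸ hU.mem_nhds hx₀.1
  exact ⟨_, (hspec m).1,
    fun y hy => ⟨hm hy, splitThrough_antitone Φ hΦ.1 x₀ (Nat.zero_le m) hy⟩, (hspec m).2⟩
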